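/- Every simple cone admits a unitary embedding into a simple normally divisible refinement cone. -/

import Mathlib

universe u

/-- Conical commutative monoid ("cone"): `x + y = 0` implies `x = y = 0`. -/
def IsConical (M : Type u) [AddCommMonoid M] : Prop :=
  ∀ x y : M, x + y = 0 → x = 0 ∧ y = 0

/-- Algebraic preorder: `x ≤ y` iff `∃ z, x + z = y`. -/
def AlgLE {M : Type u} [AddCommMonoid M] (x y : M) : Prop :=
  ∃ z : M, x + z = y

/-- Refinement monoid. -/
def IsRefinementMonoid (M : Type u) [AddCommMonoid M] : Prop :=
  ∀ a₀ a₁ b₀ b₁ : M, a₀ + a₁ = b₀ + b₁ →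
    ∃ c₀₀ c₀₁ c₁₀ c₁₁ : M,
      a₀ = c₀₀ + c₀₁ ∧ a₁ = c₁₀ + c₁₁ ∧ b₀ = c₀₀ + c₁₀ ∧ b₁ = c₀₁ + c₁₁

/-- Unitary homomorphism: injective, cofinal image, and `f a₀ + b = f a₁ → b ∈ range f`. -/
def IsUnitary {A : Type u} {B : Type u} [AddCommMonoid A] [AddCommMonoid B]
    (f : A →+ B) : Prop :=
  Function.Injective f ∧
  (∀ b : B, ∃ a : A, AlgLE b (f a)) ∧
  (∀ a₀ a₁ : A, ∀ b : B, f a₀ + b = f a₁ → b ∈ Set.range f)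

/-- Strongly unitary homomorphism. -/
def IsStronglyUnitary {A : Type u} {B : Type u} [AddCommMonoid A] [AddCommMonoid B]
    (f : A →+ B) : Prop :=
  IsUnitary f ∧ ∀ m : ℕ, 0 < m → ∀ b : B, m • b ∈ Set.range f → b ∈ Set.range f

/-- Normally divisible commutative monoid. -/
def IsNormallyDivisible (M : Type u) [AddCommMonoid M] : Prop :=
  ∀ p : ℕ, 0 < p → ∀ X : Finset M, ∀ a : M,
    ∃ u : M, p • u = a ∧ ∀ x ∈ X, ∀ y ∈ X, x + a = y + a → x + u = y + u

/-- Order-embedding of commutative monoids (w.r.t. the algebraic preorders). -/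
def IsOrderEmbeddingHom {A : Type u} {B : Type u} [AddCommMonoid A] [AddCommMonoid B]
    (f : A →+ B) : Prop :=
  Function.Injective f ∧ ∀ x y : A, AlgLE x y ↔ AlgLE (f x) (f y)

/-- Simple commutative monoid: every `u ≰ 0` is an order-unit. -/
def IsSimpleMonoid (M : Type u) [AddCommMonoid M] : Prop :=
  ∀ u : M, ¬ AlgLE u 0 → ∀ x : M, ∃ n : ℕ, 0 < n ∧ AlgLE x (n • u)

/-- Weak sum decomposition axiom (WSD). -/
def WSD (M : Type u) [AddCommMonoid M] : Prop :=
  ∀ a₀ a₁ b c : M, a₀ + a₁ + c = b + c →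
    ∃ x₀ x₁ : M, a₀ + c = x₀ + c ∧ a₁ + c = x₁ + c ∧ b = x₀ + x₁

/-- `a ∝ b` : `a ≤ n • b` for some positive integer `n`. -/
def Propto {M : Type u} [AddCommMonoid M] (a b : M) : Prop :=
  ∃ n : ℕ, 0 < n ∧ AlgLE a (n • b)

/-- `a ≍ b` : `a ∝ b` and `b ∝ a`. -/
def Asymp {M : Type u} [AddCommMonoid M] (a b : M) : Prop :=
  Propto a b ∧ Propto b a

/-- Cancellative commutative monoid. -/
def IsCancellativeMonoid (M : Type u) [AddCommMonoid M] : Prop :=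
  ∀ x y z : M, x + z = y + z → x = y

/-- Separative commutative monoid. -/
def IsSeparative (M : Type u) [AddCommMonoid M] : Prop :=
  ∀ x y : M, 2 • x = x + y → x + y = 2 • y → x = y

/-- Stably finite commutative monoid. -/
def IsStablyFinite (M : Type u) [AddCommMonoid M] : Prop :=
  ∀ x y : M, x + y = y → x = 0

/-- Quasi-divisible commutative monoid. -/
def IsQuasiDivisible (M : Type u) [AddCommMonoid M] : Prop :=
  ∀ x : M, ∃ u v : M, 2 • u + 3 • v = x

/-- `ℙ`-torsion-free commutative monoid. -/
def PTorsionFree (P : Set ℕ) (M : Type u) [AddCommMonoid M] : Prop :=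
  ∀ p ∈ P, ∀ x y : M, p • x = p • y → x = y

/-- `ℙ`-unperforated commutative monoid (w.r.t. the algebraic preorder). -/
def PUnperforated (P : Set ℕ) (M : Type u) [AddCommMonoid M] : Prop :=
  ∀ p ∈ P, ∀ x y : M, AlgLE (p • x) (p • y) → AlgLE x y

theorem IsUnitary.comp {A B C : Type u} [AddCommMonoid A] [AddCommMonoid B] [AddCommMonoid C]
    {g : B →+ C} {f : A →+ B} (hg : IsUnitary g) (hf : IsUnitary f) : IsUnitary (g.comp f) := by
  refine ⟨hg.1.comp hf.1, fun c ↦ ?_, fun a₀ a₁ c h ↦ ?_⟩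
  · obtain ⟨b, z, hz⟩ := hg.2.1 c
    obtain ⟨a, w, hw⟩ := hf.2.1 b
    exact ⟨a, z + g w, by rw [← add_assoc, hz, ← map_add, hw]; rfl⟩
  · obtain ⟨b, rfl⟩ := hg.2.2 _ _ _ h
    obtain ⟨a, rfl⟩ := hf.2.2 a₀ a₁ b (hg.1 (by simpa using h))
    exact ⟨a, rfl⟩

theorem IsUnitary.id (A : Type u) [AddCommMonoid A] : IsUnitary (AddMonoidHom.id A) :=
  ⟨fun _ _ h ↦ h, fun b ↦ ⟨b, 0, add_zero b⟩, fun _ _ b _ ↦ ⟨b, rfl⟩⟩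

section Extension

variable {M A B : Type u} [AddCommMonoid M] [AddCommMonoid A] [AddCommMonoid B]

/-- The values in `M` obtained by translating the formal sum of `z.1 : M` and `z.2 : B` by
`c : B` whenever this brings the second component into the image of `ψ`. -/
def valuesAlong (ψ : A →+ B) (φ : A →+ M) (z : M × B) (c : B) : Set M :=
  {m | ∃ s, z.2 + c = ψ s ∧ m = z.1 + φ s}

theorem valuesAlong_add (ψ : A →+ B) (φ : A →+ M) (z w : M × B) (c : B) :
    valuesAlong ψ φ (z + w) c = (w.1 + ·) '' valuesAlong ψ φ z (w.2 + c) := by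
  ext m
  simp only [valuesAlong, Set.mem_ofPred_eq, Set.mem_image, Prod.fst_add, Prod.snd_add]
  constructor
  · rintro ⟨s, h, rfl⟩
    exact ⟨_, ⟨s, by rw [← h, add_assoc], rfl⟩, by abel⟩
  · rintro ⟨_, ⟨s, h, rfl⟩, rfl⟩
    exact ⟨s, by rw [← h, add_assoc], by abel⟩

/-- Two formal sums are identified when no translation into the image of `ψ` separates them. -/
def syntacticCon (ψ : A →+ B) (φ : A →+ M) : AddCon (M × B) where
  r z w := valuesAlong ψ φ z = valuesAlong ψ φ w
  iseqv := ⟨fun _ ↦ rfl, Eq.symm, Eq.trans⟩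
  add' {a b c d} h k := by
    change valuesAlong ψ φ _ = valuesAlong ψ φ _ at h k
    have key : ∀ {x y : M × B} (z : M × B), valuesAlong ψ φ x = valuesAlong ψ φ y →
        valuesAlong ψ φ (x + z) = valuesAlong ψ φ (y + z) := fun z hxy ↦ by
      ext1 t
      rw [valuesAlong_add, valuesAlong_add, hxy]
    rw [key c h, add_comm b c, key b k, add_comm d b]

theorem exists_unitary_extension (ψ : A →+ B) (φ : A →+ M)
    (hker : ∀ s t, ψ s = ψ t → φ s = φ t)
    (hun : ∀ s t b, ψ s + b = ψ t → b ∈ Set.range ψ)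
    (hcof : ∀ b, ∃ c s, b + c = ψ s) :
    ∃ (P : Type u) (_ : AddCommMonoid P) (f : M →+ P) (g : B →+ P), IsUnitary f ∧
      (∀ s, g (ψ s) = f (φ s)) ∧
      ∀ x y b, (∀ c s, b + c = ψ s → x + φ s = y + φ s) → f x + g b = f y + g b := by
  let κ := syntacticCon ψ φ
  let f : M →+ κ.Quotient := κ.mk'.comp (AddMonoidHom.inl M B)
  let g : B →+ κ.Quotient := κ.mk'.comp (AddMonoidHom.inr M B)
  have hfg : ∀ m b, f m + g b = ((m, b) : M × B) := fun m b ↦ by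
    change κ.mk' (m, 0) + κ.mk' (0, b) = κ.mk' (m, b)
    rw [← map_add]; simp
  have hsurj : ∀ p : κ.Quotient, ∃ m b, p = f m + g b := fun p ↦ by
    induction p using AddCon.induction_on with
    | H z => exact ⟨z.1, z.2, (hfg _ _).symm⟩
  have heq : ∀ m b m' b', f m + g b = f m' + g b' ↔
      valuesAlong ψ φ (m, b) = valuesAlong ψ φ (m', b') := fun m b m' b' ↦ by
    rw [hfg, hfg]; exact AddCon.eq κ
  have hgψ : ∀ s, g (ψ s) = f (φ s) := fun s ↦ by
    have := (heq 0 (ψ s) (φ s) 0).2 ?_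
    · simpa using this
    ext c m
    simp only [valuesAlong, Set.mem_ofPred_eq, zero_add]
    constructor
    · rintro ⟨t, h, rfl⟩
      obtain ⟨r, rfl⟩ := hun _ _ _ h
      exact ⟨r, rfl, by rw [← map_add]; exact hker _ _ (by rw [map_add, h])⟩
    · rintro ⟨t, rfl, rfl⟩
      exact ⟨s + t, by simp, by simp⟩
  have hinj : Function.Injective f := fun m m' h ↦ by
    have h' := congrFun ((heq m 0 m' 0).1 (by simpa using h)) 0
    have hm : m ∈ valuesAlong ψ φ (m, 0) 0 := ⟨0, by simp, by simp⟩
    rw [h'] at hm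
    obtain ⟨s, hs, rfl⟩ := hm
    have : φ s = φ 0 := hker _ _ (by simpa using hs.symm)
    simp [this]
  refine ⟨κ.Quotient, inferInstance, f, g, ⟨hinj, fun p ↦ ?_, fun x y p h ↦ ?_⟩, hgψ, ?_⟩
  · obtain ⟨m, b, rfl⟩ := hsurj p
    obtain ⟨c, s, h⟩ := hcof b
    exact ⟨m + φ s, g c, by rw [map_add, ← hgψ, ← h, map_add, add_assoc]⟩
  · obtain ⟨m, b, rfl⟩ := hsurj p
    have h' := congrFun ((heq (x + m) b y 0).1 (by simpa [add_assoc] using h)) 0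
    have hm : y ∈ valuesAlong ψ φ (y, 0) 0 := ⟨0, by simp, by simp⟩
    rw [← h'] at hm
    obtain ⟨s, hs, -⟩ := hm
    exact ⟨m + φ s, by rw [map_add, ← hgψ, ← hs]; simp⟩
  · intro x y b h
    rw [heq]
    ext c m
    simp only [valuesAlong, Set.mem_ofPred_eq]
    exact exists_congr fun s ↦ and_congr_right fun hs ↦ by rw [h c s hs]

end Extension

theorem exists_simple_restriction {M P : Type u} [AddCommMonoid M] [AddCommMonoid P]
    (hM : IsConical M) (hMs : IsSimpleMonoid M) (hM0 : ∃ m : M, m ≠ 0)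
    (f : M →+ P) (hf : IsUnitary f) :
    ∃ S : AddSubmonoid P, (∀ m, f m ∈ S) ∧
      (∀ x : P, ∀ m : M, ∀ n : ℕ, m ≠ 0 → AlgLE (f m) (n • x) → x ∈ S) ∧
      IsConical S ∧ IsSimpleMonoid S ∧
      ∃ f' : M →+ S, IsUnitary f' ∧ ∀ m, (f' m : P) = f m := by
  have unit_iff : ∀ m : M, m ≠ 0 → ∀ x : M, ∃ n : ℕ, 0 < n ∧ AlgLE x (n • m) := fun m hm ↦
    hMs m fun ⟨z, hz⟩ ↦ hm (hM _ _ hz).1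
  have mono : ∀ {x y z : P} {n : ℕ}, AlgLE x (n • y) → AlgLE x (n • (y + z)) := by
    rintro x y z n ⟨w, hw⟩
    exact ⟨w + n • z, by rw [← add_assoc, hw, nsmul_add]⟩
  have nonneg_false : ∀ m : M, m ≠ 0 → ¬ AlgLE (f m) 0 := by
    rintro m hm ⟨z, hz⟩
    obtain ⟨a, rfl⟩ := hf.2.2 m 0 z (by simpa using hz)
    exact hm (hM m a (hf.1 (by simpa using hz))).1
  let S : AddSubmonoid P :=
    { carrier := {x | x = 0 ∨ ∃ m : M, ∃ n : ℕ, m ≠ 0 ∧ AlgLE (f m) (n • x)}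
      zero_mem' := Or.inl rfl
      add_mem' := by
        rintro x y (rfl | ⟨m, n, hm, h⟩) hy
        · simpa using hy
        · exact Or.inr ⟨m, n, hm, mono h⟩ }
  have hfS : ∀ m, f m ∈ S := fun m ↦ by
    by_cases hm : m = 0
    · exact Or.inl (by simp [hm])
    · exact Or.inr ⟨m, 1, hm, 0, by simp⟩
  obtain ⟨e, he⟩ := hM0
  have hcof : ∀ b : S, ∃ a, AlgLE b ((⟨f a, hfS a⟩ : S)) := by
    rintro ⟨b, hb⟩
    obtain ⟨a, z, hz⟩ := hf.2.1 b
    refine ⟨a + e, ⟨z + f e, Or.inr ⟨e, 1, he, z, by rw [one_nsmul, add_comm]⟩⟩, ?_⟩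
    apply Subtype.ext
    simp [← add_assoc, hz]
  refine ⟨S, hfS, fun x m n hm h ↦ Or.inr ⟨m, n, hm, h⟩, ?_, ?_,
    f.codRestrict S hfS, ⟨fun x y h ↦ hf.1 (congrArg Subtype.val h), hcof, ?_⟩, fun m ↦ rfl⟩
  · have aux : ∀ x y : S, x + y = 0 → x = 0 := by
      rintro ⟨x, rfl | ⟨m, n, hm, h⟩⟩ ⟨y, hy⟩ hxy
      · rfl
      · have hxy' : x + y = 0 := congrArg Subtype.val hxy
        refine (nonneg_false m hm ?_).elim
        have := mono (z := y) h
        rwa [hxy', smul_zero] at this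
    exact fun x y h ↦ ⟨aux x y h, aux y x (by rwa [add_comm])⟩
  · rintro ⟨u, rfl | ⟨m, n, hm, z, hz⟩⟩ hu x
    · exact (hu ⟨0, by ext; simp⟩).elim
    · obtain ⟨a, w, hw⟩ := hcof x
      obtain ⟨k, -, v, hv⟩ := unit_iff m hm a
      have hw' : (x : P) + w = f a := congrArg Subtype.val hw
      refine ⟨k * n + 1, Nat.succ_pos _,
        ⟨w + f v + k • z + u, Or.inr ⟨m, n, hm, ?_⟩⟩, ?_⟩
      · rw [add_comm]
        exact mono ⟨z, hz⟩
      · apply Subtype.ext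
        change (x : P) + (w + f v + k • z + u) = (k * n + 1) • u
        rw [add_smul, one_smul, mul_smul, ← hz, smul_add, ← map_nsmul, ← hv, map_add, ← hw']
        abel
  · rintro a₀ a₁ ⟨b, hb⟩ h
    obtain ⟨a, rfl⟩ := hf.2.2 a₀ a₁ b (congrArg Subtype.val h)
    exact ⟨a, rfl⟩

/-- A solvable system over `M`: a homomorphism from a free monoid of rank four to `M`, to be
extended along `ψ`. -/
structure ExtensionProblem (M : Type u) [AddCommMonoid M] where
  ψ : (Fin 4 → ℕ) →+ (Fin 4 → ℕ)
  φ : (Fin 4 → ℕ) →+ M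
  ker_le : ∀ s t, ψ s = ψ t → φ s = φ t
  unitary : ∀ s t b, ψ s + b = ψ t → b ∈ Set.range ψ
  cofinal : ∀ b, ∃ c s, b + c = ψ s

theorem ExtensionProblem.exists_simultaneous_solution (M : Type u) [AddCommMonoid M] :
    ∃ (P : Type u) (_ : AddCommMonoid P) (f : M →+ P)
      (g : ExtensionProblem M → (Fin 4 → ℕ) →+ P), IsUnitary f ∧
      (∀ Q s, g Q (Q.ψ s) = f (Q.φ s)) ∧
      ∀ Q x y b, (∀ c s, b + c = Q.ψ s → x + Q.φ s = y + Q.φ s) →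
        f x + g Q b = f y + g Q b := by
  classical
  let ψ : (ExtensionProblem M →₀ (Fin 4 → ℕ)) →+ (ExtensionProblem M →₀ (Fin 4 → ℕ)) :=
    Finsupp.liftAddHom fun Q ↦ (Finsupp.singleAddHom Q).comp Q.ψ
  let φ : (ExtensionProblem M →₀ (Fin 4 → ℕ)) →+ M := Finsupp.liftAddHom ExtensionProblem.φ
  have hψ : ∀ s Q, ψ s Q = Q.ψ (s Q) := fun s Q ↦ by
    induction s using Finsupp.induction_linear with
    | zero => simp
    | add s t hs ht => simp [hs, ht]
    | single R a =>
      by_cases h : R = Q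
      · subst h; simp [ψ]
      · simp [ψ, h]
  have hφs : ∀ (Q : ExtensionProblem M) a, φ (Finsupp.single Q a) = Q.φ a := fun Q a ↦ by simp [φ]
  have hψs : ∀ (Q : ExtensionProblem M) a, ψ (Finsupp.single Q a) = Finsupp.single Q (Q.ψ a) := fun Q a ↦ by simp [ψ]
  have hφ : ∀ s (Q : ExtensionProblem M), ∃ r, φ s = Q.φ (s Q) + r := fun s Q ↦
    ⟨φ (s.erase Q), by rw [← hφs, ← map_add, Finsupp.single_add_erase]⟩
  have lift : ∀ (p : ExtensionProblem M → (Fin 4 → ℕ) → (Fin 4 → ℕ) → Prop)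
      (_ : ∀ Q, p Q 0 0) (b : ExtensionProblem M →₀ (Fin 4 → ℕ)),
      (∀ Q, ∃ c, p Q (b Q) c) → ∃ c : ExtensionProblem M →₀ (Fin 4 → ℕ), ∀ Q, p Q (b Q) (c Q) := by
    intro p hp b h
    choose c hc using h
    refine ⟨Finsupp.onFinset b.support (fun Q ↦ if b Q = 0 then 0 else c Q) ?_, fun Q ↦ ?_⟩
    · intro Q hQ
      by_contra hb
      simp_all
    · by_cases hb : b Q = 0
      · simpa [hb] using hp Q
      · simpa [hb] using hc Q
  have hker : ∀ s t, ψ s = ψ t → φ s = φ t := by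
    intro s t h
    change s.sum _ = t.sum _
    rw [Finsupp.sum_of_support_subset s Finset.subset_union_left _ (by simp),
      Finsupp.sum_of_support_subset t (Finset.subset_union_right (s₁ := s.support)) _ (by simp)]
    refine Finset.sum_congr rfl fun Q _ ↦ Q.ker_le _ _ ?_
    rw [← hψ, ← hψ, h]
  have hun : ∀ s t b, ψ s + b = ψ t → b ∈ Set.range ψ := by
    intro s t b h
    obtain ⟨c, hc⟩ := lift (fun Q b c ↦ Q.ψ c = b) (fun Q ↦ map_zero _) b fun Q ↦
      Q.unitary (s Q) (t Q) _ (by rw [← hψ, ← hψ, ← h]; rfl)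
    exact ⟨c, Finsupp.ext fun Q ↦ by rw [hψ, hc]⟩
  have hcof : ∀ b, ∃ c s, b + c = ψ s := by
    intro b
    obtain ⟨c, hc⟩ := lift (fun Q b c ↦ ∃ s, b + c = Q.ψ s) (fun Q ↦ ⟨0, by simp⟩) b
      fun Q ↦ Q.cofinal (b Q)
    obtain ⟨s, hs⟩ := lift (fun Q d s ↦ d = Q.ψ s) (fun Q ↦ (map_zero _).symm) (b + c) hc
    exact ⟨c, s, Finsupp.ext fun Q ↦ by rw [hψ, ← hs]⟩
  obtain ⟨P, inst, f, g, hf, hgf, hg⟩ := exists_unitary_extension ψ φ hker hun hcof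
  refine ⟨P, inst, f, fun Q ↦ g.comp (Finsupp.singleAddHom Q), hf, fun Q s ↦ ?_,
    fun Q x y b h ↦ hg x y _ fun c s hs ↦ ?_⟩
  · rw [← hφs, ← hgf, hψs]; rfl
  · obtain ⟨r, hr⟩ := hφ s Q
    have := h (c Q) (s Q) (by rw [← hψ, ← hs]; simp)
    rw [hr, ← add_assoc, this, add_assoc]

/-- The homomorphism from the free monoid of rank four sending the basis to `v`. -/
def tupleHom {M : Type u} [AddCommMonoid M] (v : Fin 4 → M) : (Fin 4 → ℕ) →+ M where
  toFun s := s 0 • v 0 + s 1 • v 1 + s 2 • v 2 + s 3 • v 3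
  map_zero' := by simp
  map_add' s t := by simp only [Pi.add_apply, add_smul]; abel

/-- The system `p • u = a` in the unknown `u`. -/
def divisionProblem {M : Type u} [AddCommMonoid M] {p : ℕ} (hp : 0 < p) (a : M) :
    ExtensionProblem M where
  ψ :=
    { toFun s := ![p * s 0, s 1, s 2, s 3]
      map_zero' := by ext i; fin_cases i <;> simp
      map_add' s t := by ext i; fin_cases i <;> simp [mul_add] }
  φ := tupleHom ![a, 0, 0, 0]
  ker_le s t h := by
    have := congrFun h 0
    simp only [AddMonoidHom.coe_mk, ZeroHom.coe_mk, Matrix.cons_val_zero] at this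
    simp [tupleHom, Nat.eq_of_mul_eq_mul_left hp this]
  unitary s t b h := by
    have h0 : p * s 0 + b 0 = p * t 0 := congrFun h 0
    obtain ⟨k, hk⟩ : p ∣ b 0 := (Nat.dvd_add_right (dvd_mul_right p (s 0))).1 ⟨_, h0⟩
    refine ⟨![k, b 1, b 2, b 3], ?_⟩
    ext i; fin_cases i <;> simp [hk]
  cofinal b := by
    obtain ⟨q, rfl⟩ : ∃ q, p = q + 1 := ⟨p - 1, by omega⟩
    refine ⟨![q * b 0, 0, 0, 0], b, ?_⟩
    ext i; fin_cases i <;> simp [add_mul, add_comm]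

/-- The system `n • d = x`, `d + e = y`, `n • e = r` in the unknowns `d`, `e`. -/
def lowerBoundProblem {M : Type u} [AddCommMonoid M] {n : ℕ} {x y r : M} (hn : 0 < n)
    (h : n • y = x + r) : ExtensionProblem M where
  ψ :=
    { toFun s := ![n * s 0 + s 1, s 1 + n * s 2, s 3, s 3]
      map_zero' := by ext i; fin_cases i <;> simp
      map_add' s t := by ext i; fin_cases i <;> simp <;> ring }
  φ := tupleHom ![x, y, r, 0]
  ker_le s t hst := by
    have h0 : n * s 0 + s 1 = n * t 0 + t 1 := congrFun hst 0
    have h1 : s 1 + n * s 2 = t 1 + n * t 2 := congrFun hst 1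
    have key : ∀ i j k i' j' k' : ℕ, n * i + j = n * i' + j' → j + n * k = j' + n * k' →
        i ≤ i' → i • x + j • y + k • r = i' • x + j' • y + k' • r := by
      intro i j k i' j' k' h0 h1 hi
      obtain ⟨t, rfl⟩ := Nat.exists_eq_add_of_le hi
      have hj : j = j' + n * t := by linarith [mul_add n i t]
      have hk : k' = k + t := Nat.eq_of_mul_eq_mul_left hn (by linarith [mul_add n k t])
      subst hj hk
      rw [add_smul j', mul_comm n t, mul_smul, h, smul_add, add_smul, add_smul]
      abel
    have := (le_total (s 0) (t 0)).elim (key _ _ _ _ _ _ h0 h1)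
      fun hi ↦ (key _ _ _ _ _ _ h0.symm h1.symm hi).symm
    simpa [tupleHom] using this
  unitary s t b hst := by
    have h0 : n * s 0 + s 1 + b 0 = n * t 0 + t 1 := congrFun hst 0
    have h1 : s 1 + n * s 2 + b 1 = t 1 + n * t 2 := congrFun hst 1
    have h2 : s 3 + b 2 = t 3 := congrFun hst 2
    have h3 : s 3 + b 3 = t 3 := congrFun hst 3
    have h23 : b 2 = b 3 := by omega
    have hmod : b 0 ≡ b 1 [MOD n] := by
      have e0 : s 1 + b 0 ≡ t 1 [MOD n] := by
        have := congrArg (· % n) h0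
        simpa [Nat.ModEq, add_assoc] using this
      have e1 : s 1 + b 1 ≡ t 1 [MOD n] := by
        have := congrArg (· % n) h1
        rw [add_right_comm] at this
        simpa [Nat.ModEq] using this
      exact Nat.ModEq.add_left_cancel' _ (e0.trans e1.symm)
    rcases le_total (b 0) (b 1) with hle | hle
    · obtain ⟨k, hk⟩ := (Nat.modEq_iff_dvd' hle).1 hmod
      refine ⟨![0, b 0, k, b 3], ?_⟩
      ext i; fin_cases i <;> simp <;> omega
    · obtain ⟨k, hk⟩ := (Nat.modEq_iff_dvd' hle).1 hmod.symm
      refine ⟨![k, b 1, 0, b 3], ?_⟩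
      ext i; fin_cases i <;> simp <;> omega
  cofinal b := by
    refine ⟨![b 1, b 0, b 3, b 2], ![0, b 0 + b 1, 0, b 2 + b 3], ?_⟩
    ext i; fin_cases i <;> simp <;> ring

/-- The system `aᵢ = cᵢ₀ + cᵢ₁`, `bⱼ = c₀ⱼ + c₁ⱼ` in the unknowns `cᵢⱼ`. -/
def refinementProblem {M : Type u} [AddCommMonoid M] {a₀ a₁ b₀ b₁ : M}
    (h : a₀ + a₁ = b₀ + b₁) : ExtensionProblem M where
  ψ :=
    { toFun s := ![s 0 + s 2, s 0 + s 3, s 1 + s 2, s 1 + s 3]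
      map_zero' := by ext i; fin_cases i <;> simp
      map_add' s t := by ext i; fin_cases i <;> simp <;> ring }
  φ := tupleHom ![a₀, a₁, b₀, b₁]
  ker_le s t hst := by
    have h0 : s 0 + s 2 = t 0 + t 2 := congrFun hst 0
    have h1 : s 0 + s 3 = t 0 + t 3 := congrFun hst 1
    have h2 : s 1 + s 2 = t 1 + t 2 := congrFun hst 2
    have key : ∀ i j k l i' j' k' l' : ℕ, i + k = i' + k' → i + l = i' + l' →
        j + k = j' + k' → i ≤ i' →
        i • a₀ + j • a₁ + k • b₀ + l • b₁ = i' • a₀ + j' • a₁ + k' • b₀ + l' • b₁ := by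
      intro i j k l i' j' k' l' h0 h1 h2 hi
      obtain ⟨t, rfl⟩ := Nat.exists_eq_add_of_le hi
      obtain rfl : k = k' + t := by omega
      obtain rfl : l = l' + t := by omega
      obtain rfl : j' = j + t := by omega
      have ht : t • a₀ + t • a₁ = t • b₀ + t • b₁ := by rw [← smul_add, h, smul_add]
      calc i • a₀ + j • a₁ + (k' + t) • b₀ + (l' + t) • b₁
          = i • a₀ + j • a₁ + k' • b₀ + l' • b₁ + (t • b₀ + t • b₁) := by
            rw [add_smul, add_smul]; abel
        _ = _ := by rw [← ht, add_smul, add_smul]; abel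
    have := (le_total (s 0) (t 0)).elim (key _ _ _ _ _ _ _ _ h0 h1 h2)
      fun hi ↦ (key _ _ _ _ _ _ _ _ h0.symm h1.symm h2.symm hi).symm
    simpa [tupleHom] using this
  unitary s t b hst := by
    have h0 : s 0 + s 2 + b 0 = t 0 + t 2 := congrFun hst 0
    have h1 : s 0 + s 3 + b 1 = t 0 + t 3 := congrFun hst 1
    have h2 : s 1 + s 2 + b 2 = t 1 + t 2 := congrFun hst 2
    have h3 : s 1 + s 3 + b 3 = t 1 + t 3 := congrFun hst 3
    rcases le_total (b 0) (b 2) with hle | hle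
    · refine ⟨![0, b 2 - b 0, b 0, b 1], ?_⟩
      ext i; fin_cases i <;> simp <;> omega
    · refine ⟨![b 0 - b 2, 0, b 2, b 3], ?_⟩
      ext i; fin_cases i <;> simp <;> omega
  cofinal b := by
    refine ⟨![b 1 + b 2 + b 3, b 0 + b 2 + b 3, b 0 + b 1 + b 3, b 0 + b 1 + b 2],
      ![b 0 + b 1 + b 2 + b 3, b 0 + b 1 + b 2 + b 3, 0, 0], ?_⟩
    ext i; fin_cases i <;> simp <;> ring

/-- Every instance over `M` of division, of a common lower bound of two nonzero elements, and of
refinement after enlarging all four terms by `2 • d`, is solvable in `N`. -/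
structure SolvesSystems {M N : Type u} [AddCommMonoid M] [AddCommMonoid N] (f : M →+ N) :
    Prop where
  divide : ∀ p : ℕ, 0 < p → ∀ a : M,
    ∃ u : N, p • u = f a ∧ ∀ x y : M, x + a = y + a → f x + u = f y + u
  lowerBound : ∀ x y : M, x ≠ 0 → y ≠ 0 → ∃ d : N, d ≠ 0 ∧ AlgLE d (f x) ∧ AlgLE d (f y)
  refine_add : ∀ d a₀ a₁ b₀ b₁ : M, d ≠ 0 → a₀ + a₁ = b₀ + b₁ → ∃ c₀₀ c₀₁ c₁₀ c₁₁ : N,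
    f (2 • d + a₀) = c₀₀ + c₀₁ ∧ f (2 • d + a₁) = c₁₀ + c₁₁ ∧
    f (2 • d + b₀) = c₀₀ + c₁₀ ∧ f (2 • d + b₁) = c₀₁ + c₁₁

theorem exists_solving_extension (M : Type u) [AddCommMonoid M] (hM : IsConical M)
    (hMs : IsSimpleMonoid M) (hM0 : ∃ m : M, m ≠ 0) :
    ∃ (N : Type u) (_ : AddCommMonoid N), IsConical N ∧ IsSimpleMonoid N ∧
      ∃ f : M →+ N, IsUnitary f ∧ SolvesSystems f := by
  obtain ⟨P, _, f, g, hf, hgψ, hg⟩ := ExtensionProblem.exists_simultaneous_solution M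
  obtain ⟨S, hfS, hS, hSc, hSs, f', hf', hff'⟩ := exists_simple_restriction hM hMs hM0 f hf
  refine ⟨S, inferInstance, hSc, hSs, f', hf', ?_, ?_, ?_⟩
  · intro p hp a
    by_cases ha : a = 0
    · subst ha
      exact ⟨0, by simp, fun x y h ↦ by rw [add_zero, add_zero] at h; rw [h]⟩
    let Q := divisionProblem hp a
    have hu : p • g Q ![1, 0, 0, 0] = f a := by
      rw [← map_nsmul]
      convert hgψ Q ![1, 0, 0, 0] using 2
      · ext i; fin_cases i <;> simp [Q, divisionProblem]
      · simp [Q, divisionProblem, tupleHom]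
    refine ⟨⟨_, hS _ a p ha ⟨0, by rw [hu, add_zero]⟩⟩, ?_, fun x y h ↦ ?_⟩
    · apply Subtype.ext
      simpa [hff'] using hu
    · apply Subtype.ext
      simp only [AddSubmonoid.coe_add, hff']
      refine hg Q x y _ fun c s hs ↦ ?_
      have h0 : 1 + c 0 = p * s 0 := congrFun hs 0
      obtain ⟨k, hk⟩ : ∃ k, s 0 = k + 1 := ⟨s 0 - 1, by
        rcases Nat.eq_zero_or_pos (s 0) with h | h
        · rw [h] at h0; omega
        · omega⟩
      simp only [Q, divisionProblem, tupleHom, AddMonoidHom.coe_mk, ZeroHom.coe_mk, hk]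
      simp only [Matrix.cons_val, smul_zero, add_zero]
      rw [add_smul, one_smul, add_comm (k • a), ← add_assoc, h, add_assoc]
  · intro x y hx hy
    obtain ⟨n, hn, r, hr⟩ := hMs y (fun ⟨z, hz⟩ ↦ hy (hM _ _ hz).1) x
    have hry : r + y ≠ 0 := fun h ↦ hy (hM _ _ h).2
    let Q := lowerBoundProblem (n := n + 1) (x := x) (y := y) (r := r + y) (Nat.succ_pos n)
      (by rw [add_smul, one_smul, ← hr, add_assoc])
    have hd : (n + 1) • g Q ![1, 0, 0, 0] = f x := by
      rw [← map_nsmul]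
      convert hgψ Q ![1, 0, 0, 0] using 2
      · ext i; fin_cases i <;> simp [Q, lowerBoundProblem]
      · simp [Q, lowerBoundProblem, tupleHom]
    have he : (n + 1) • g Q ![0, 1, 0, 0] = f (r + y) := by
      rw [← map_nsmul]
      convert hgψ Q ![0, 0, 1, 0] using 2
      · ext i; fin_cases i <;> simp [Q, lowerBoundProblem]
      · simp [Q, lowerBoundProblem, tupleHom]
    have hde : g Q ![1, 0, 0, 0] + g Q ![0, 1, 0, 0] = f y := by
      rw [← map_add]
      convert hgψ Q ![0, 1, 0, 0] using 2
      · ext i; fin_cases i <;> simp [Q, lowerBoundProblem]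
      · simp [Q, lowerBoundProblem, tupleHom]
    let d : S := ⟨_, hS _ x (n + 1) hx ⟨0, by rw [hd, add_zero]⟩⟩
    let e : S := ⟨_, hS _ (r + y) (n + 1) hry ⟨0, by rw [he, add_zero]⟩⟩
    have hd' : (n + 1) • d = f' x := Subtype.ext (by rw [hff']; exact hd)
    refine ⟨d, fun h ↦ hx (hf'.1 ?_), ⟨n • d, by rw [← hd', add_smul, one_smul, add_comm]⟩,
      ⟨e, Subtype.ext (by rw [hff']; exact hde)⟩⟩
    rw [← hd', h, smul_zero, map_zero]
  · intro d a₀ a₁ b₀ b₁ hd h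
    let Q := refinementProblem h
    have hc : ∀ v, f d + g Q v ∈ S := fun v ↦ hS _ d 1 hd ⟨g Q v, by rw [one_smul]⟩
    have key : ∀ (v w s : Fin 4 → ℕ) (m : M), v + w = Q.ψ s → Q.φ s = m →
        f' (2 • d + m) = (⟨_, hc v⟩ : S) + ⟨_, hc w⟩ := fun v w s m hv hm ↦ by
      apply Subtype.ext
      change (f' (2 • d + m) : P) = f d + g Q v + (f d + g Q w)
      rw [hff', map_add, ← hm, ← hgψ, ← hv, two_smul, map_add, map_add]
      abel
    refine ⟨⟨_, hc ![1, 0, 0, 0]⟩, ⟨_, hc ![0, 1, 0, 0]⟩, ⟨_, hc ![0, 0, 1, 0]⟩,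
      ⟨_, hc ![0, 0, 0, 1]⟩, key _ _ ![1, 0, 0, 0] _ ?_ ?_, key _ _ ![0, 1, 0, 0] _ ?_ ?_,
      key _ _ ![0, 0, 1, 0] _ ?_ ?_, key _ _ ![0, 0, 0, 1] _ ?_ ?_⟩
    all_goals first
      | (ext i; fin_cases i <;> simp [Q, refinementProblem])
      | simp [Q, refinementProblem, tupleHom]

theorem exists_sequential_limit (G : ℕ → Type u) [∀ n, AddCommMonoid (G n)]
    (f : ∀ n, G n →+ G (n + 1)) (hf : ∀ n, IsUnitary (f n)) :
    ∃ (L : Type u) (_ : AddCommMonoid L) (i : ∀ n, G n →+ L), (∀ n, IsUnitary (i n)) ∧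
      (∀ n x, i (n + 1) (f n x) = i n x) ∧ ∀ y, ∃ n x, i n x = y := by
  let F : ∀ m n, m ≤ n → (G m →+ G n) := fun m n h ↦
    Nat.leRec (motive := fun n _ ↦ G m →+ G n) (AddMonoidHom.id _) (fun k _ g ↦ (f k).comp g) h
  have F_self : ∀ m, F m m le_rfl = AddMonoidHom.id _ := fun m ↦ Nat.leRec_self ..
  have F_succ : ∀ m n (h : m ≤ n), F m (n + 1) (h.trans n.le_succ) = (f n).comp (F m n h) :=
    fun m n h ↦ Nat.leRec_succ ..
  have F_comp : ∀ m n k (h : m ≤ n) (h' : n ≤ k), (F n k h').comp (F m n h) = F m k (h.trans h') := by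
    intro m n k h h'
    induction k, h' using Nat.le_induction with
    | base => rw [F_self]; rfl
    | succ k hk ih => rw [F_succ n k hk, F_succ m k (h.trans hk), ← ih]; rfl
  have F_unitary : ∀ m n h, IsUnitary (F m n h) := by
    intro m n h
    induction n, h using Nat.le_induction with
    | base => rw [F_self]; exact IsUnitary.id _
    | succ k hk ih => rw [F_succ m k hk]; exact (hf k).comp ih
  have : DirectedSystem G (F · · ·) :=
    ⟨fun i x ↦ by simp [F_self], fun k j i h h' x ↦ DFunLike.congr_fun (F_comp _ _ _ h h') x⟩
  let i : ∀ n, G n →+ DirectLimit G F := fun n ↦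
    { toFun x := ⟦⟨n, x⟩⟧
      map_zero' := (DirectLimit.zero_def n).symm
      map_add' x y := (DirectLimit.add_def n x y).symm }
  have i_F : ∀ m n h x, i n (F m n h x) = i m x := fun m n h x ↦ DirectLimit.mk_apply ..
  have i_inj : ∀ n, Function.Injective (i n) :=
    fun n ↦ DirectLimit.mk_injective _ (fun m n h ↦ (F_unitary m n h).1) n
  have i_surj : ∀ n y, ∃ k, ∃ h : n ≤ k, ∃ x, i k x = y := fun n y ↦ by
    obtain ⟨m, x, rfl⟩ := DirectLimit.exists_eq_mk F y
    exact ⟨max n m, le_max_left _ _, F m _ (le_max_right _ _) x, i_F ..⟩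
  refine ⟨DirectLimit G F, inferInstance, i, fun n ↦ ⟨i_inj n, fun y ↦ ?_, fun a₀ a₁ y h ↦ ?_⟩,
    fun n x ↦ ?_, fun y ↦ ?_⟩
  · obtain ⟨k, h, x, rfl⟩ := i_surj n y
    obtain ⟨a, z, hz⟩ := (F_unitary n k h).2.1 x
    exact ⟨a, i k z, by rw [← map_add, hz, i_F]⟩
  · obtain ⟨k, hk, x, rfl⟩ := i_surj n y
    rw [← i_F n k hk a₀, ← i_F n k hk a₁, ← map_add] at h
    obtain ⟨a, rfl⟩ := (F_unitary n k hk).2.2 _ _ _ (i_inj k h)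
    exact ⟨a, (i_F ..).symm⟩
  · have := i_F n (n + 1) n.le_succ x
    rwa [F_succ n n le_rfl, F_self] at this
  · obtain ⟨k, -, x, hx⟩ := i_surj 0 y
    exact ⟨k, x, hx⟩

/-- A nonzero simple cone. -/
structure SimpleCone where
  carrier : Type u
  [inst : AddCommMonoid carrier]
  conical : IsConical carrier
  simple : IsSimpleMonoid carrier
  nonzero : ∃ m : carrier, m ≠ 0

attribute [instance] SimpleCone.inst

theorem SimpleCone.exists_extension (C : SimpleCone.{u}) :
    ∃ (D : SimpleCone.{u}) (f : C.carrier →+ D.carrier), IsUnitary f ∧ SolvesSystems f := by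
  obtain ⟨N, _, hN, hNs, f, hf, hs⟩ := exists_solving_extension C.carrier C.conical C.simple
    C.nonzero
  obtain ⟨m, hm⟩ := C.nonzero
  exact ⟨⟨N, hN, hNs, f m, fun h ↦ hm (hf.1 (by rw [h, map_zero]))⟩, f, hf, hs⟩

theorem SimpleCone.exists_limit (C : SimpleCone.{u}) :
    ∃ (L : Type u) (_ : AddCommMonoid L), IsConical L ∧ IsSimpleMonoid L ∧
      IsNormallyDivisible L ∧
      (∀ x y : L, x ≠ 0 → y ≠ 0 → ∃ d : L, d ≠ 0 ∧ AlgLE d x ∧ AlgLE d y) ∧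
      (∀ d a₀ a₁ b₀ b₁ : L, d ≠ 0 → a₀ + a₁ = b₀ + b₁ → ∃ c₀₀ c₀₁ c₁₀ c₁₁ : L,
        2 • d + a₀ = c₀₀ + c₀₁ ∧ 2 • d + a₁ = c₁₀ + c₁₁ ∧
        2 • d + b₀ = c₀₀ + c₁₀ ∧ 2 • d + b₁ = c₀₁ + c₁₁) ∧
      ∃ f : C.carrier →+ L, IsUnitary f := by
  obtain ⟨D, rfl, step, hstep, hsol⟩ : ∃ D : ℕ → SimpleCone.{u}, D 0 = C ∧
      ∃ step : ∀ n, (D n).carrier →+ (D (n + 1)).carrier,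
        (∀ n, IsUnitary (step n)) ∧ ∀ n, SolvesSystems (step n) := by
    choose next step hstep hsol using SimpleCone.exists_extension.{u}
    exact ⟨Nat.rec C fun _ ↦ next, rfl, fun n ↦ step _, fun n ↦ hstep _, fun n ↦ hsol _⟩
  obtain ⟨L, instL, i, hi, hi_step, hi_surj⟩ :=
    exists_sequential_limit (fun n ↦ (D n).carrier) step hstep
  have range_le : ∀ {m n : ℕ}, m ≤ n → ∀ x, ∃ x', i n x' = i m x := by
    intro m n h
    induction n, h using Nat.le_induction with
    | base => exact fun x ↦ ⟨x, rfl⟩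
    | succ k _ ih =>
      intro x
      obtain ⟨y, hy⟩ := ih x
      exact ⟨step k y, by rw [hi_step, hy]⟩
  have common : ∀ X : Finset L, ∃ n, ∀ y ∈ X, ∃ x, i n x = y := by
    classical
    intro X
    induction X using Finset.induction_on with
    | empty => exact ⟨0, by simp⟩
    | insert a X _ ih =>
      obtain ⟨n, hn⟩ := ih
      obtain ⟨m, x, rfl⟩ := hi_surj a
      refine ⟨max n m, fun y hy ↦ ?_⟩
      rcases Finset.mem_insert.1 hy with rfl | hy
      · exact range_le (le_max_right n m) x
      · obtain ⟨z, rfl⟩ := hn y hy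
        exact range_le (le_max_left n m) z
  have common₂ : ∀ a b : L, ∃ n x y, i n x = a ∧ i n y = b := by
    classical
    intro a b
    obtain ⟨n, hn⟩ := common {a, b}
    obtain ⟨x, hx⟩ := hn a (by simp)
    obtain ⟨y, hy⟩ := hn b (by simp)
    exact ⟨n, x, y, hx, hy⟩
  have divide : ∀ p : ℕ, 0 < p → ∀ X : Finset L, ∀ a : L,
      ∃ u : L, p • u = a ∧ ∀ x ∈ X, ∀ y ∈ X, x + a = y + a → x + u = y + u := by
    classical
    intro p hp X a
    obtain ⟨n, hn⟩ := common (insert a X)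
    obtain ⟨a, rfl⟩ := hn a (by simp)
    obtain ⟨u, hu, hxy⟩ := (hsol n).divide p hp a
    refine ⟨i (n + 1) u, by rw [← map_nsmul, hu, hi_step], fun x hx y hy h ↦ ?_⟩
    obtain ⟨x, rfl⟩ := hn x (Finset.mem_insert_of_mem hx)
    obtain ⟨y, rfl⟩ := hn y (Finset.mem_insert_of_mem hy)
    rw [← map_add, ← map_add] at h
    rw [← hi_step n x, ← hi_step n y, ← map_add, ← map_add, hxy x y ((hi n).1 h)]
  have ne_zero : ∀ {n : ℕ} {x : (D n).carrier}, i n x ≠ 0 → x ≠ 0 := fun h hx ↦ h (by rw [hx, map_zero])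
  have map_le : ∀ {n : ℕ} {x y : (D n).carrier}, AlgLE x y → AlgLE (i n x) (i n y) := by
    rintro n x y ⟨z, hz⟩
    exact ⟨i n z, by rw [← map_add, hz]⟩
  refine ⟨L, instL, ?_, ?_, divide, ?_, ?_, i 0, hi 0⟩
  · intro a b h
    obtain ⟨n, x, y, rfl, rfl⟩ := common₂ a b
    obtain ⟨rfl, rfl⟩ := (D n).conical x y ((hi n).1 (by rw [map_add, h, map_zero]))
    simp
  · intro a ha b
    obtain ⟨n, x, y, rfl, rfl⟩ := common₂ a b
    obtain ⟨k, hk, h⟩ := (D n).simple x (fun h ↦ ha (by simpa using map_le h)) y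
    exact ⟨k, hk, by simpa using map_le h⟩
  · intro a b ha hb
    obtain ⟨n, x, y, rfl, rfl⟩ := common₂ a b
    obtain ⟨d, hd, h, h'⟩ := (hsol n).lowerBound x y (ne_zero ha) (ne_zero hb)
    refine ⟨i (n + 1) d, fun h0 ↦ hd ((hi (n + 1)).1 (by rw [h0, map_zero])), ?_, ?_⟩
    · simpa [hi_step] using map_le (n := n + 1) h
    · simpa [hi_step] using map_le (n := n + 1) h'
  · classical
    intro d a₀ a₁ b₀ b₁ hd h
    obtain ⟨n, hn⟩ := common {d, a₀, a₁, b₀, b₁}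
    obtain ⟨d, rfl⟩ := hn d (by simp)
    obtain ⟨a₀, rfl⟩ := hn a₀ (by simp)
    obtain ⟨a₁, rfl⟩ := hn a₁ (by simp)
    obtain ⟨b₀, rfl⟩ := hn b₀ (by simp)
    obtain ⟨b₁, rfl⟩ := hn b₁ (by simp)
    rw [← map_add, ← map_add] at h
    obtain ⟨c₀₀, c₀₁, c₁₀, c₁₁, h₁, h₂, h₃, h₄⟩ :=
      (hsol n).refine_add d a₀ a₁ b₀ b₁ (ne_zero hd) ((hi n).1 h)
    refine ⟨i (n + 1) c₀₀, i (n + 1) c₀₁, i (n + 1) c₁₀, i (n + 1) c₁₁, ?_, ?_, ?_, ?_⟩ <;>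
      rw [← map_add] <;> simp only [← h₁, ← h₂, ← h₃, ← h₄, hi_step,
        map_add, map_nsmul]

theorem isRefinementMonoid_of_normallyDivisible {L : Type u} [AddCommMonoid L]
    (hdiv : IsNormallyDivisible L)
    (hlower : ∀ x y : L, x ≠ 0 → y ≠ 0 → ∃ d : L, d ≠ 0 ∧ AlgLE d x ∧ AlgLE d y)
    (hrefine : ∀ d a₀ a₁ b₀ b₁ : L, d ≠ 0 → a₀ + a₁ = b₀ + b₁ → ∃ c₀₀ c₀₁ c₁₀ c₁₁ : L,
      2 • d + a₀ = c₀₀ + c₀₁ ∧ 2 • d + a₁ = c₁₀ + c₁₁ ∧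
      2 • d + b₀ = c₀₀ + c₁₀ ∧ 2 • d + b₁ = c₀₁ + c₁₁) :
    IsRefinementMonoid L := by
  classical
  intro a₀ a₁ b₀ b₁ h
  by_cases ha₀ : a₀ = 0
  · subst ha₀
    exact ⟨0, 0, b₀, b₁, by simpa using h⟩
  by_cases ha₁ : a₁ = 0
  · subst ha₁
    exact ⟨b₀, b₁, 0, 0, by simpa using h⟩
  by_cases hb₀ : b₀ = 0
  · subst hb₀
    exact ⟨0, a₀, 0, a₁, by simpa using h.symm⟩
  by_cases hb₁ : b₁ = 0
  · subst hb₁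
    exact ⟨a₀, 0, a₁, 0, by simpa using h.symm⟩
  obtain ⟨d₀, hd₀, ⟨r₀, rfl⟩, ⟨r₁, rfl⟩⟩ := hlower a₀ a₁ ha₀ ha₁
  obtain ⟨d₁, hd₁, ⟨s₀, rfl⟩, ⟨s₁, rfl⟩⟩ := hlower b₀ b₁ hb₀ hb₁
  obtain ⟨d, hd, ⟨t₀, rfl⟩, ⟨t₁, rfl⟩⟩ := hlower d₀ d₁ hd₀ hd₁
  let x := t₀ + r₀ + (t₀ + r₁)
  let y := t₁ + s₀ + (t₁ + s₁)
  obtain ⟨e, rfl, he⟩ := hdiv 6 (by norm_num) {x + d, y + d} d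
  have hxy : x + 6 • e + e = y + 6 • e + e := by
    refine he _ (by simp) _ (by simp) ?_
    convert h using 1 <;> simp only [x, y] <;> abel
  obtain ⟨c₀₀, c₀₁, c₁₀, c₁₁, h₁, h₂, h₃, h₄⟩ := hrefine e (4 • e + (t₀ + r₀)) (4 • e + (t₀ + r₁))
    (4 • e + (t₁ + s₀)) (4 • e + (t₁ + s₁)) (fun h0 ↦ hd (by rw [h0, smul_zero])) (by
      convert congrArg (· + e) hxy using 1 <;> simp only [x, y] <;> abel)
  refine ⟨c₀₀, c₀₁, c₁₀, c₁₁, ?_, ?_, ?_, ?_⟩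
  · rw [← h₁]; abel
  · rw [← h₂]; abel
  · rw [← h₃]; abel
  · rw [← h₄]; abel

/-- Every simple cone admits a unitary embedding into a simple normally
divisible refinement cone. -/
theorem simple_cone_unitary_embeds
    (M : Type u) [AddCommMonoid M] (hM : IsConical M) (hMs : IsSimpleMonoid M) :
    ∃ (N : Type u) (_ : AddCommMonoid N),
      IsConical N ∧ IsSimpleMonoid N ∧ IsNormallyDivisible N ∧ IsRefinementMonoid N ∧
      ∃ f : M →+ N, IsUnitary f := by
  by_cases hM0 : ∃ m : M, m ≠ 0
  · obtain ⟨L, inst, hL, hLs, hdiv, hlower, hrefine, f, hf⟩ :=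
      SimpleCone.exists_limit ⟨M, hM, hMs, hM0⟩
    exact ⟨L, inst, hL, hLs, hdiv,
      isRefinementMonoid_of_normallyDivisible hdiv hlower hrefine, f, hf⟩
  · have hM0 : Subsingleton M := ⟨fun a b ↦ by
      push Not at hM0
      rw [hM0 a, hM0 b]⟩
    exact ⟨M, inferInstance, hM, hMs,
      fun _ _ _ _ ↦ ⟨0, Subsingleton.elim _ _, fun _ _ _ _ _ ↦ Subsingleton.elim _ _⟩,
      fun _ _ _ _ _ ↦ ⟨0, 0, 0, 0, Subsingleton.elim _ _, Subsingleton.elim _ _,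
        Subsingleton.elim _ _, Subsingleton.elim _ _⟩,
      AddMonoidHom.id M, IsUnitary.id M⟩
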